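/- arXiv:0712.3026 — 2 statements merged into one kernel-verified Lean document; each statement's English description precedes it below -/
import Mathlib

section
/- Let T be a positive-weighted tree with leaf set [n], n ≥ 4, and let α, α′ ∈ [n] be neighbours in T. Then for all distinct x, y ∈ [n]∖{α,α′}, the length of the twig of α equals ½(D_{α,α′}(T) + D_{α,x,y}(T) − D_{α′,x,y}(T)); in particular this value does not depend on x, y. -/
/-- A weighted tree whose leaves are labeled bijectively by `Fin n`. -/
structure WeightedTree (n : ℕ) where
  V : Type
  [fintypeV : Fintype V]
  [decEqV : DecidableEq V]
  G : SimpleGraph V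
  [decAdj : DecidableRel G.Adj]
  isTree : G.IsTree
  w : Sym2 V → ℝ
  leaf : Fin n → V
  leaf_inj : Function.Injective leaf
  leaf_iff : ∀ v : V, (∃ i, leaf i = v) ↔ G.degree v ≤ 1

attribute [instance] WeightedTree.fintypeV WeightedTree.decEqV WeightedTree.decAdj

namespace WeightedTree

variable {n : ℕ}

/-- The unique path between two vertices of a tree. -/
noncomputable def treePath (T : WeightedTree n) (u v : T.V) : T.G.Walk u v :=
  (T.isTree.existsUnique_path u v).choose

/-- The sum of the weights of the edges on the path from `u` to `v`. -/
noncomputable def pathWeight (T : WeightedTree n) (u v : T.V) : ℝ :=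
  ((T.treePath u v).edges.map T.w).sum

open Classical in
/-- The total weight of the minimal subtree spanning the leaves indexed by `S`:
the sum of the weights of the edges lying on a path between two leaves of `S`. -/
noncomputable def D (T : WeightedTree n) (S : Finset (Fin n)) : ℝ :=
  ∑ e ∈ T.G.edgeFinset.filter
      (fun e => ∃ i ∈ S, ∃ j ∈ S, e ∈ (T.treePath (T.leaf i) (T.leaf j)).edges),
    T.w e

/-- All edge weights are positive. -/
def PosWeights (T : WeightedTree n) : Prop := ∀ e ∈ T.G.edgeSet, 0 < T.w e

/-- Two leaves are neighbours (form a cherry) if the path between them contains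
exactly one vertex of degree at least 3. -/
def Neighbours (T : WeightedTree n) (a b : Fin n) : Prop :=
  ∃! z : T.V, z ∈ (T.treePath (T.leaf a) (T.leaf b)).support ∧ 3 ≤ T.G.degree z

end WeightedTree

open WeightedTree

namespace WeightedTree

variable {n : ℕ} (T : WeightedTree n)

theorem isPath_treePath (u v : T.V) : (T.treePath u v).IsPath :=
  (T.isTree.existsUnique_path u v).choose_spec.1

theorem eq_treePath {u v : T.V} {p : T.G.Walk u v} (hp : p.IsPath) : p = T.treePath u v :=
  (T.isTree.existsUnique_path u v).choose_spec.2 p hp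

theorem treePath_reverse (u v : T.V) : (T.treePath u v).reverse = T.treePath v u :=
  T.eq_treePath (T.isPath_treePath u v).reverse

theorem mem_edges_treePath_comm {e : Sym2 T.V} {u v : T.V} :
    e ∈ (T.treePath u v).edges ↔ e ∈ (T.treePath v u).edges := by
  rw [← T.treePath_reverse u v]
  simp

theorem edges_treePath_subset {u v : T.V} (p : T.G.Walk u v) :
    (T.treePath u v).edges ⊆ p.edges := by
  rw [← T.eq_treePath p.bypass_isPath]
  exact p.edges_bypass_subset_edges

theorem support_treePath_subset {u v : T.V} (p : T.G.Walk u v) :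
    (T.treePath u v).support ⊆ p.support := by
  rw [← T.eq_treePath p.bypass_isPath]
  exact p.support_bypass_subset_support

theorem notMem_edges_treePath_self (e : Sym2 T.V) (u : T.V) :
    e ∉ (T.treePath u u).edges := by
  intro h
  simpa using T.edges_treePath_subset .nil h

theorem notMem_edges_treePath_trans {e : Sym2 T.V} {u v w : T.V}
    (huv : e ∉ (T.treePath u v).edges) (hvw : e ∉ (T.treePath v w).edges) :
    e ∉ (T.treePath u w).edges := by
  intro h
  have := T.edges_treePath_subset ((T.treePath u v).append (T.treePath v w)) h
  simp_all

/-- An edge lies on at most one of the two halves into which a vertex divides a path. -/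
theorem notMem_edges_of_mem_support {e : Sym2 T.V} {u v z : T.V}
    (hz : z ∈ (T.treePath u v).support) (he : e ∈ (T.treePath u z).edges) :
    e ∉ (T.treePath v z).edges := by
  rw [T.mem_edges_treePath_comm]
  intro he'
  have hp := T.isPath_treePath u v
  have hnd := hp.isTrail.edges_nodup
  rw [← (T.treePath u v).take_spec hz, SimpleGraph.Walk.edges_append,
    T.eq_treePath (hp.takeUntil hz), T.eq_treePath (hp.dropUntil hz)] at hnd
  exact (List.nodup_append.1 hnd).2.2 e he e he' rfl

theorem two_le_degree_of_adj {v c d : T.V} (hc : T.G.Adj v c) (hd : T.G.Adj v d) (h : c ≠ d) :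
    2 ≤ T.G.degree v := by
  rw [← SimpleGraph.card_neighborFinset_eq_degree, ← Finset.card_pair h]
  exact Finset.card_le_card (by simp [Finset.insert_subset_iff, hc, hd])

/-- If a path starts at a vertex of degree at most one, then the neighbours of a vertex of the path
of degree at most two, other than the end, lie on the path. -/
theorem mem_support_of_adj_getVert {u z : T.V} (p : T.G.Walk u z) (hp : p.IsPath)
    (hu : T.G.degree u ≤ 1) {i : ℕ} (hi : i < p.length) (hdeg : T.G.degree (p.getVert i) ≤ 2)
    {c : T.V} (hc : T.G.Adj (p.getVert i) c) : c ∈ p.support := by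
  by_contra hcs
  have hsucc := p.adj_getVert_succ hi
  have hne : c ≠ p.getVert (i + 1) := by
    rintro rfl
    exact hcs (p.getVert_mem_support _)
  rcases Nat.eq_zero_or_pos i with rfl | hpos
  · have := T.two_le_degree_of_adj hc hsucc hne
    rw [p.getVert_zero] at this
    omega
  · obtain ⟨j, rfl⟩ : ∃ j, i = j + 1 := ⟨i - 1, by omega⟩
    have hpred := (p.adj_getVert_succ (i := j) (by omega)).symm
    have hne' : c ≠ p.getVert j := by
      rintro rfl
      exact hcs (p.getVert_mem_support _)
    have hne'' : p.getVert j ≠ p.getVert (j + 1 + 1) := by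
      intro h
      have := hp.getVert_injOn (by simp; omega) (by simp; omega) h
      omega
    have : 3 ≤ T.G.degree (p.getVert (j + 1)) := by
      rw [← SimpleGraph.card_neighborFinset_eq_degree,
        ← Finset.card_eq_three.2 ⟨c, _, _, hne', hne, hne'', rfl⟩]
      exact Finset.card_le_card (by simp [Finset.insert_subset_iff, hc, hsucc, hpred])
    omega

/-- An interior vertex of a path has degree at least two. -/
theorem two_le_degree_getVert {u z : T.V} (p : T.G.Walk u z) (hp : p.IsPath) {i : ℕ}
    (h0 : 0 < i) (hi : i < p.length) : 2 ≤ T.G.degree (p.getVert i) := by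
  obtain ⟨j, rfl⟩ : ∃ j, i = j + 1 := ⟨i - 1, by omega⟩
  have hsucc := p.adj_getVert_succ hi
  have hpred := (p.adj_getVert_succ (i := j) (by omega)).symm
  have hne : p.getVert j ≠ p.getVert (j + 1 + 1) := by
    intro h
    have := hp.getVert_injOn (by simp; omega) (by simp; omega) h
    omega
  exact T.two_le_degree_of_adj hpred hsucc hne

/-- A walk leaving a set whose only outer boundary vertex is `z` passes through `z`. -/
theorem mem_support_of_boundary {S : Set T.V} {z : T.V}
    (hS : ∀ v ∈ S, ∀ c, T.G.Adj v c → c ∈ S ∨ c = z) {u v : T.V} (p : T.G.Walk u v)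
    (hu : u ∈ S) (hv : v ∉ S) : z ∈ p.support := by
  induction p with
  | nil => exact absurd hu hv
  | cons h p ih =>
    rcases hS _ hu _ h with hc | rfl
    · simp [ih hc hv]
    · simp

/-- The path from a leaf of a cherry to any other leaf passes through the stalk. -/
theorem stalk_mem_support {a b c z : T.V} (ha : T.G.degree a ≤ 1) (hc : T.G.degree c ≤ 1)
    (hca : c ≠ a) (hz : z ∈ (T.treePath a b).support) (hz3 : 3 ≤ T.G.degree z)
    (huniq : ∀ v ∈ (T.treePath a b).support, 3 ≤ T.G.degree v → v = z) :
    z ∈ (T.treePath a c).support := by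
  have hp := T.isPath_treePath a z
  have hsub : (T.treePath a z).support ⊆ (T.treePath a b).support :=
    fun v hv => (T.treePath a b).support_takeUntil_subset_support hz
      (T.support_treePath_subset _ hv)
  have hlt : ∀ v ∈ (T.treePath a z).support, v ≠ z →
      ∃ i < (T.treePath a z).length, (T.treePath a z).getVert i = v := by
    intro v hv hvz
    obtain ⟨i, rfl, hi⟩ := SimpleGraph.Walk.mem_support_iff_exists_getVert.1 hv
    refine ⟨i, lt_of_le_of_ne hi ?_, rfl⟩
    rintro rfl
    exact hvz (T.treePath a z).getVert_length
  refine T.mem_support_of_boundary (S := {v | v ∈ (T.treePath a z).support ∧ v ≠ z}) ?_ _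
    ⟨SimpleGraph.Walk.start_mem_support _, ?_⟩ ?_
  · rintro v ⟨hv, hvz⟩ d hd
    have hdeg : T.G.degree v ≤ 2 := by
      by_contra! h
      exact hvz (huniq v (hsub hv) h)
    obtain ⟨i, hi, rfl⟩ := hlt v hv hvz
    have := T.mem_support_of_adj_getVert _ hp ha hi hdeg hd
    by_cases hdz : d = z
    · exact .inr hdz
    · exact .inl ⟨this, hdz⟩
  · rintro rfl
    omega
  · rintro ⟨hv, hvz⟩
    obtain ⟨i, hi, rfl⟩ := hlt c hv hvz
    rcases Nat.eq_zero_or_pos i with rfl | hpos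
    · exact hca (SimpleGraph.Walk.getVert_zero _)
    · have := T.two_le_degree_getVert _ hp hpos hi
      omega

open Classical in
theorem pathWeight_eq_sum (u v : T.V) :
    T.pathWeight u v =
      ∑ e ∈ T.G.edgeFinset, if e ∈ (T.treePath u v).edges then T.w e else 0 := by
  rw [pathWeight, ← List.sum_toFinset _ (T.isPath_treePath u v).isTrail.edges_nodup,
    ← Finset.sum_filter]
  refine Finset.sum_congr ?_ fun _ _ => rfl
  ext e
  simp only [List.mem_toFinset, Finset.mem_filter, SimpleGraph.mem_edgeFinset]
  exact ⟨fun h => ⟨SimpleGraph.Walk.edges_subset_edgeSet _ h, h⟩, fun h => h.2⟩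

theorem degree_leaf_le_one (i : Fin n) : T.G.degree (T.leaf i) ≤ 1 :=
  (T.leaf_iff _).1 ⟨i, rfl⟩

end WeightedTree

/-- in a positive-weighted tree with leaf set `[n]`, `n ≥ 4`, if
`α, α'` are neighbours with stalk `z`, then the length of the twig of `α`
equals `½(D_{α,α'} + D_{α,x,y} - D_{α',x,y})` for any distinct
`x, y ∈ [n] ∖ {α,α'}`; in particular this value does not depend on `x, y`. -/
theorem twig_length_from_triple_weights (n : ℕ) (hn : 4 ≤ n)
    (T : WeightedTree n) (hpos : T.PosWeights)
    (α α' : Fin n) (hαα' : α ≠ α') (hnbr : T.Neighbours α α')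
    (z : T.V)
    (hz : z ∈ (T.treePath (T.leaf α) (T.leaf α')).support ∧ 3 ≤ T.G.degree z)
    (x y : Fin n) (hxy : x ≠ y) (hxα : x ≠ α) (hxα' : x ≠ α')
    (hyα : y ≠ α) (hyα' : y ≠ α') :
    T.pathWeight (T.leaf α) z =
      (T.D {α, α'} + T.D {α, x, y} - T.D {α', x, y}) / 2 := by
  classical
  obtain ⟨hz, hz3⟩ := hz
  have huniq : ∀ v ∈ (T.treePath (T.leaf α) (T.leaf α')).support, 3 ≤ T.G.degree v → v = z :=
    fun v hv h => hnbr.unique ⟨hv, h⟩ ⟨hz, hz3⟩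
  have hrev : ∀ v, v ∈ (T.treePath (T.leaf α') (T.leaf α)).support ↔
      v ∈ (T.treePath (T.leaf α) (T.leaf α')).support := fun v => by
    simp [← T.treePath_reverse (T.leaf α) (T.leaf α')]
  have stalk : ∀ c, c ≠ α → z ∈ (T.treePath (T.leaf α) (T.leaf c)).support := fun c hc =>
    T.stalk_mem_support (T.degree_leaf_le_one α) (T.degree_leaf_le_one c)
      (T.leaf_inj.ne hc) hz hz3 huniq
  have stalk' : ∀ c, c ≠ α' → z ∈ (T.treePath (T.leaf α') (T.leaf c)).support := fun c hc =>
    T.stalk_mem_support (T.degree_leaf_le_one α') (T.degree_leaf_le_one c)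
      (T.leaf_inj.ne hc) ((hrev z).2 hz) hz3 fun v hv => huniq v ((hrev v).1 hv)
  have key : T.pathWeight (T.leaf α) z + T.pathWeight (T.leaf α) z + T.D {α', x, y} =
      T.D {α, α'} + T.D {α, x, y} := by
    simp only [D, T.pathWeight_eq_sum, Finset.sum_filter, ← Finset.sum_add_distrib]
    refine Finset.sum_congr rfl fun e _ => ?_
    have refl := T.notMem_edges_treePath_self e
    have symm : ∀ u v, e ∉ (T.treePath u v).edges → e ∉ (T.treePath v u).edges :=
      fun u v h => mt T.mem_edges_treePath_comm.1 h
    have trans : ∀ u v w, e ∉ (T.treePath u v).edges → e ∉ (T.treePath v w).edges →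
        e ∉ (T.treePath u w).edges := fun u v w => T.notMem_edges_treePath_trans
    have hα : ∀ c, c ≠ α → e ∈ (T.treePath (T.leaf α) z).edges →
        e ∉ (T.treePath (T.leaf c) z).edges :=
      fun c hc => T.notMem_edges_of_mem_support (stalk c hc)
    have hα' : ∀ c, c ≠ α' → e ∈ (T.treePath (T.leaf α') z).edges →
        e ∉ (T.treePath (T.leaf c) z).edges :=
      fun c hc => T.notMem_edges_of_mem_support (stalk' c hc)
    have span_pair : ∀ a b : Fin n, (∃ i ∈ ({a, b} : Finset (Fin n)),
        ∃ j ∈ ({a, b} : Finset (Fin n)),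
        e ∈ (T.treePath (T.leaf i) (T.leaf j)).edges) ↔
        e ∈ (T.treePath (T.leaf a) (T.leaf b)).edges := by
      intro a b
      simp only [Finset.mem_insert, Finset.mem_singleton, exists_eq_or_imp, exists_eq_left]
      grind
    have span_triple : ∀ a : Fin n, (∃ i ∈ ({a, x, y} : Finset (Fin n)),
        ∃ j ∈ ({a, x, y} : Finset (Fin n)),
        e ∈ (T.treePath (T.leaf i) (T.leaf j)).edges) ↔
        e ∈ (T.treePath (T.leaf a) (T.leaf x)).edges ∨
        e ∈ (T.treePath (T.leaf a) (T.leaf y)).edges := by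
      intro a
      simp only [Finset.mem_insert, Finset.mem_singleton, exists_eq_or_imp, exists_eq_left]
      grind
    simp only [span_pair, span_triple]
    by_cases h : e ∈ (T.treePath (T.leaf α) z).edges
    · have h₁ := hα α' hαα'.symm h
      have h₂ := hα x hxα h
      have h₃ := hα y hyα h
      have h₄ : e ∈ (T.treePath (T.leaf α) (T.leaf α')).edges := by
        by_contra h'
        exact trans _ _ _ h' h₁ h
      have h₅ : e ∈ (T.treePath (T.leaf α) (T.leaf x)).edges := by
        by_contra h'
        exact trans _ _ _ h' h₂ h
      have h₆ := trans _ _ _ h₁ (symm _ _ h₂)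
      have h₇ := trans _ _ _ h₁ (symm _ _ h₃)
      simp [h, h₄, h₅, h₆, h₇]
    · by_cases h' : e ∈ (T.treePath (T.leaf α') z).edges
      · have h₂ := hα' x hxα' h'
        have h₃ := hα' y hyα' h'
        have h₄ : e ∈ (T.treePath (T.leaf α) (T.leaf α')).edges := by
          by_contra h''
          exact trans _ _ _ (symm _ _ h'') h h'
        have h₅ : e ∈ (T.treePath (T.leaf α') (T.leaf x)).edges := by
          by_contra h''
          exact trans _ _ _ h'' h₂ h'
        have h₆ := trans _ _ _ h (symm _ _ h₂)
        have h₇ := trans _ _ _ h (symm _ _ h₃)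
        simp [h, h₄, h₅, h₆, h₇]
      · have h₁ := trans _ _ _ h (symm _ _ h')
        have hiff : ∀ c, e ∈ (T.treePath (T.leaf α) (T.leaf c)).edges ↔
            e ∈ (T.treePath (T.leaf α') (T.leaf c)).edges := fun c =>
          not_iff_not.1 ⟨trans _ _ _ (symm _ _ h₁), trans _ _ _ h₁⟩
        simp [h, h₁, hiff]
  linarith
end

section
/- (Pachter–Speyer) Let k, n ∈ ℕ with k ≥ 3 and n ≥ 2k−1. Let T and T′ be positive-weighted trees, each with leaf set [n] and with no vertices of degree 2. If D_I(T) = D_I(T′) for every k-element subset I of [n], then there is an isomorphism of weighted trees from T to T′, i.e., a graph isomorphism preserving the lengths of corresponding edges and fixing the labels of the leaves. -/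
open WeightedTree

/-- An isomorphism of weighted trees: a graph isomorphism which preserves the
lengths of corresponding edges and fixes the labels of the leaves. -/
def WeightedTreeIso {n : ℕ} (T T' : WeightedTree n) : Prop :=
  ∃ φ : T.G ≃g T'.G,
    (∀ e ∈ T.G.edgeSet, T'.w (Sym2.map φ e) = T.w e) ∧
    ∀ i : Fin n, φ (T.leaf i) = T'.leaf i

section SplitWeights

variable {ι : Type*} [DecidableEq ι]

/-- The indicator of the event that the split `A | Aᶜ` separates two elements of `I`. -/
def cutIndicator (I A : Finset ι) : ℝ := if I ⊆ A ∨ Disjoint I A then 0 else 1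

/-- The contribution of the split `A | Aᶜ` to the four-point expression on `i, j, k, l`
relative to `R`. -/
def quartetCoeff (R : Finset ι) (i j k l : ι) (A : Finset ι) : ℝ :=
  cutIndicator (insert i (insert k R)) A + cutIndicator (insert j (insert l R)) A
    - cutIndicator (insert i (insert j R)) A - cutIndicator (insert k (insert l R)) A

theorem quartetCoeff_eq {R : Finset ι} (hR : R.Nonempty) (i j k l : ι) (A : Finset ι) :
    quartetCoeff R i j k l A = if R ⊆ A ∨ Disjoint R A then
      ((if i ∈ A then 1 else 0) - (if l ∈ A then 1 else 0)) *
        ((if j ∈ A then 1 else 0) - (if k ∈ A then 1 else 0)) else 0 := by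
  have hRA : ¬ (R ⊆ A ∧ Disjoint R A) := fun ⟨h₁, h₂⟩ =>
    hR.ne_empty (Finset.disjoint_self_iff_empty R |>.1 (h₂.mono_right h₁))
  unfold quartetCoeff cutIndicator
  simp only [Finset.insert_subset_iff, Finset.disjoint_insert_left]
  by_cases h1 : R ⊆ A <;> by_cases h2 : Disjoint R A <;> by_cases hi : i ∈ A <;>
    by_cases hj : j ∈ A <;> by_cases hk : k ∈ A <;> by_cases hl : l ∈ A <;>
    simp_all

theorem quartetCoeff_eq_one {R : Finset ι} (hR : R.Nonempty) {i j k l : ι} {A : Finset ι}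
    (hi : i ∈ A) (hj : j ∈ A) (hk : k ∉ A) (hl : l ∉ A) (hRA : R ⊆ A ∨ Disjoint R A) :
    quartetCoeff R i j k l A = 1 := by
  rw [quartetCoeff_eq hR, if_pos hRA]
  simp [hi, hj, hk, hl]

variable [Fintype ι]

/-- A weight function on splits of `ι`, both sides of a split carrying its weight, whose support is
pairwise compatible and contains all trivial splits. -/
structure IsCompatibleSplitWeight (w : Finset ι → ℝ) : Prop where
  nonneg : ∀ A, 0 ≤ w A
  compl : ∀ A, w Aᶜ = w A
  empty : w ∅ = 0
  singleton_pos : ∀ i, 0 < w {i}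
  compat : ∀ ⦃A B⦄, 0 < w A → 0 < w B → ∀ ⦃i j k l⦄, i ∈ A → i ∈ B → j ∈ A → j ∉ B →
    k ∉ A → k ∈ B → l ∉ A → l ∉ B → False

/-- The total weight of the splits separating elements of `I`, each split being counted once for
each of its sides. -/
def splitDiversity (w : Finset ι → ℝ) (I : Finset ι) : ℝ := ∑ A, w A * cutIndicator I A

/-- Some split of positive weight separates `i, j` from `k, l`. -/
def HasQuartet (w : Finset ι → ℝ) (i j k l : ι) : Prop :=
  ∃ A, 0 < w A ∧ i ∈ A ∧ j ∈ A ∧ k ∉ A ∧ l ∉ A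

namespace IsCompatibleSplitWeight

variable {w w' : Finset ι → ℝ}

theorem subset_or_subset (hw : IsCompatibleSplitWeight w) {A B : Finset ι} (hA : 0 < w A)
    (hB : 0 < w B) {i k : ι} (hiA : i ∈ A) (hiB : i ∈ B) (hkA : k ∉ A) (hkB : k ∉ B) :
    A ⊆ B ∨ B ⊆ A := by
  by_contra! h
  obtain ⟨x, hx, hx'⟩ := Finset.not_subset.1 h.1
  obtain ⟨y, hy, hy'⟩ := Finset.not_subset.1 h.2
  exact hw.compat hA hB hiA hiB hx hx' hy' hy hkA hkB

theorem hasQuartet_of_quartetCoeff_pos (hw : IsCompatibleSplitWeight w) {R : Finset ι}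
    (hR : R.Nonempty) {i j k l : ι} {A : Finset ι} (hA : 0 < w A)
    (hc : 0 < quartetCoeff R i j k l A) :
    ∃ B, (B = A ∨ B = Aᶜ) ∧ 0 < w B ∧ i ∈ B ∧ j ∈ B ∧ k ∉ B ∧ l ∉ B := by
  rw [quartetCoeff_eq hR] at hc
  split_ifs at hc <;> norm_num at hc
  · exact ⟨A, by simp_all⟩
  · exact ⟨Aᶜ, by simp_all [hw.compl]⟩

theorem quartetCoeff_nonneg (hw : IsCompatibleSplitWeight w) {R : Finset ι}
    (hR : R.Nonempty) {i j k l : ι} (hq : HasQuartet w i j k l) {A : Finset ι} (hA : 0 < w A) :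
    0 ≤ quartetCoeff R i j k l A := by
  obtain ⟨B, hB, hi, hj, hk, hl⟩ := hq
  rw [quartetCoeff_eq hR]
  split_ifs <;> norm_num
  · exact hw.compat hA hB ‹_› hi ‹k ∈ A› hk ‹_› hj ‹_› hl
  · exact hw.compat hA hB ‹_› hj ‹l ∈ A› hl ‹_› hi ‹_› hk

/-- The larger side of a split supplies `m - 2` elements avoiding a given quartet. -/
theorem exists_card_subset_side {m : ℕ} (hm : 3 ≤ m) (hn : 2 * m - 1 ≤ Fintype.card ι)
    (A : Finset ι) {i j k l : ι} (hi : i ∈ A) (hj : j ∈ A) (hk : k ∉ A) (hl : l ∉ A) :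
    ∃ R : Finset ι, R.card = m - 2 ∧ (R ⊆ A ∨ Disjoint R A) ∧
      i ∉ R ∧ j ∉ R ∧ k ∉ R ∧ l ∉ R := by
  have key : ∀ (B : Finset ι) (x y : ι), m ≤ B.card → ∃ R ⊆ (B.erase x).erase y,
      R.card = m - 2 := by
    intro B x y hB
    apply Finset.exists_subset_card_eq
    have := Finset.pred_card_le_card_erase (s := B) (a := x)
    have := Finset.pred_card_le_card_erase (s := B.erase x) (a := y)
    omega
  have hc := Finset.card_add_card_compl A
  by_cases hA : m ≤ A.card
  · obtain ⟨R, hR, hRc⟩ := key A i j hA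
    exact ⟨R, hRc, Or.inl fun x hx => by grind, by grind, by grind, by grind, by grind⟩
  · obtain ⟨R, hR, hRc⟩ := key Aᶜ k l (by omega)
    have hR' : ∀ x ∈ R, x ∉ A ∧ x ≠ k ∧ x ≠ l := fun x hx => by
      have := hR hx
      simp at this
      tauto
    exact ⟨R, hRc, Or.inr (Finset.disjoint_left.2 fun x hx => (hR' x hx).1),
      by grind, by grind, by grind, by grind⟩

theorem sum_quartetCoeff_eq {m : ℕ} (hm : 3 ≤ m)
    (hD : ∀ I : Finset ι, I.card = m → splitDiversity w I = splitDiversity w' I)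
    {i j k l : ι} (hij : i ≠ j) (hkl : k ≠ l) (hik : i ≠ k) (hjl : j ≠ l) {R : Finset ι}
    (hR : R.card = m - 2) (hi : i ∉ R) (hj : j ∉ R) (hk : k ∉ R) (hl : l ∉ R) :
    ∑ A, w A * quartetCoeff R i j k l A = ∑ A, w' A * quartetCoeff R i j k l A := by
  have key : ∀ {x y : ι}, x ≠ y → x ∉ R → y ∉ R →
      splitDiversity w (insert x (insert y R)) = splitDiversity w' (insert x (insert y R)) := by
    intro x y hxy hx hy
    apply hD
    rw [Finset.card_insert_of_notMem (by simp [hxy, hx]), Finset.card_insert_of_notMem hy, hR]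
    omega
  have h1 := key hik hi hk
  have h2 := key hjl hj hl
  have h3 := key hij hi hj
  have h4 := key hkl hk hl
  unfold splitDiversity at h1 h2 h3 h4
  simp only [quartetCoeff, mul_sub, mul_add, Finset.sum_sub_distrib, Finset.sum_add_distrib,
    h1, h2, h3, h4]

theorem hasQuartet_of_splitDiversity_eq (hw : IsCompatibleSplitWeight w)
    (hw' : IsCompatibleSplitWeight w') {m : ℕ} (hm : 3 ≤ m) (hn : 2 * m - 1 ≤ Fintype.card ι)
    (hD : ∀ I : Finset ι, I.card = m → splitDiversity w I = splitDiversity w' I)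
    {i j k l : ι} (hij : i ≠ j) (hkl : k ≠ l) (hq : HasQuartet w i j k l) :
    HasQuartet w' i j k l := by
  obtain ⟨A, hA, hi, hj, hk, hl⟩ := id hq
  obtain ⟨R, hRc, hRA, hiR, hjR, hkR, hlR⟩ := exists_card_subset_side hm hn A hi hj hk hl
  have hR : R.Nonempty := Finset.card_pos.1 (by omega)
  have hsum := sum_quartetCoeff_eq hm hD hij hkl (ne_of_mem_of_not_mem hi hk)
    (ne_of_mem_of_not_mem hj hl) hRc hiR hjR hkR hlR
  have hpos : 0 < ∑ A, w A * quartetCoeff R i j k l A := by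
    refine Finset.sum_pos' (fun B _ => ?_) ⟨A, Finset.mem_univ _, ?_⟩
    · rcases (hw.nonneg B).eq_or_lt with h | h
      · simp [← h]
      · exact mul_nonneg h.le (hw.quartetCoeff_nonneg hR hq h)
    · simpa [quartetCoeff_eq_one hR hi hj hk hl hRA] using hA
  rw [hsum] at hpos
  obtain ⟨B, -, hB⟩ := Finset.exists_lt_of_sum_lt (by simpa using hpos :
    ∑ A : Finset ι, (0 : ℝ) < ∑ A, w' A * quartetCoeff R i j k l A)
  obtain ⟨C, -, hC⟩ := hw'.hasQuartet_of_quartetCoeff_pos hR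
    ((hw'.nonneg B).lt_of_ne fun h => by simp [← h] at hB)
    (pos_of_mul_pos_right hB (hw'.nonneg B))
  exact ⟨C, hC⟩

/-- A split all of whose quartets are displayed by a compatible split system belongs to it. -/
theorem pos_of_forall_hasQuartet (hw : IsCompatibleSplitWeight w) {A : Finset ι}
    (hA : A.Nonempty) (hAc : 1 < Aᶜ.card)
    (hq : ∀ i j k l, i ∈ A → j ∈ A → i ≠ j → k ∉ A → l ∉ A → k ≠ l → HasQuartet w i j k l) :
    0 < w A := by
  obtain ⟨a, ha⟩ := hA
  obtain ⟨b, hb, b', hb', hbb'⟩ := Finset.one_lt_card.1 hAc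
  rw [Finset.mem_compl] at hb hb'
  obtain ⟨C, hC, hmax⟩ := Finset.exists_max_image
    (Finset.univ.filter fun C => 0 < w C ∧ a ∈ C ∧ C ⊆ A) Finset.card
    ⟨{a}, by simp [hw.singleton_pos, ha]⟩
  simp only [Finset.mem_filter, Finset.mem_univ, true_and, and_imp] at hC hmax
  obtain ⟨hC, haC, hCA⟩ := hC
  suffices A ⊆ C by rwa [this.antisymm hCA]
  by_contra hAC
  obtain ⟨k, hkA, hkC⟩ := Finset.not_subset.1 hAC
  have hak : a ≠ k := ne_of_mem_of_not_mem haC hkC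
  obtain ⟨B, hB, haB, hkB, hbB, -⟩ := hq a k b b' ha hkA hak hb hb' hbb'
  obtain ⟨E, hE, hmin⟩ := Finset.exists_min_image
    (Finset.univ.filter fun E => 0 < w E ∧ a ∈ E ∧ k ∈ E ∧ b ∉ E) Finset.card
    ⟨B, by simp [*]⟩
  simp only [Finset.mem_filter, Finset.mem_univ, true_and, and_imp] at hE hmin
  obtain ⟨hE, haE, hkE, hbE⟩ := hE
  have hEA : E ⊆ A := by
    intro x hxE
    by_contra hxA
    obtain ⟨F, hF, haF, hkF, hbF, hxF⟩ := hq a k b x ha hkA hak hb hxA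
      (ne_of_mem_of_not_mem hxE hbE).symm
    rcases hw.subset_or_subset hE hF haE haF hbE hbF with h | h
    · exact hxF (h hxE)
    · have := Finset.eq_of_subset_of_card_le h (hmin F hF haF hkF hbF)
      exact hxF (this ▸ hxE)
  rcases hw.subset_or_subset hC hE haC haE (fun h => hb (hCA h)) hbE with h | h
  · have := Finset.eq_of_subset_of_card_le h (hmax E hE haE hEA)
    exact hkC (this ▸ hkE)
  · exact hkC (h hkE)

theorem univ (hw : IsCompatibleSplitWeight w) : w Finset.univ = 0 := by
  rw [← Finset.compl_empty, hw.compl, hw.empty]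

theorem one_lt_card_or (hw : IsCompatibleSplitWeight w) {A : Finset ι} (hA : 0 < w A) :
    (1 < A.card ∧ 1 < Aᶜ.card) ∨ ∃ i, A = {i} ∨ A = {i}ᶜ := by
  have h0 : A.card ≠ 0 := fun h => by
    rw [Finset.card_eq_zero.1 h, hw.empty] at hA
    exact hA.false
  have h0' : Aᶜ.card ≠ 0 := fun h => by
    rw [Finset.card_eq_zero, Finset.compl_eq_empty_iff] at h
    rw [h, hw.univ] at hA
    exact hA.false
  by_cases h1 : A.card = 1
  · obtain ⟨i, hi⟩ := Finset.card_eq_one.1 h1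
    exact Or.inr ⟨i, Or.inl hi⟩
  by_cases h2 : Aᶜ.card = 1
  · obtain ⟨i, hi⟩ := Finset.card_eq_one.1 h2
    exact Or.inr ⟨i, Or.inr (by rw [← hi, compl_compl])⟩
  exact Or.inl ⟨by omega, by omega⟩

theorem pos_of_splitDiversity_eq (hw : IsCompatibleSplitWeight w)
    (hw' : IsCompatibleSplitWeight w') {m : ℕ} (hm : 3 ≤ m) (hn : 2 * m - 1 ≤ Fintype.card ι)
    (hD : ∀ I : Finset ι, I.card = m → splitDiversity w I = splitDiversity w' I)
    {A : Finset ι} (hA : 0 < w A) : 0 < w' A := by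
  rcases hw.one_lt_card_or hA with ⟨h1, h2⟩ | ⟨i, rfl | rfl⟩
  · exact hw'.pos_of_forall_hasQuartet (Finset.card_pos.1 (by omega)) h2
      fun i j k l hi hj hij hk hl hkl =>
        hw.hasQuartet_of_splitDiversity_eq hw' hm hn hD hij hkl ⟨A, hA, hi, hj, hk, hl⟩
  · exact hw'.singleton_pos i
  · rw [hw'.compl]
    exact hw'.singleton_pos i

/-- Inside a side `A` of a split, every element has a partner such that no smaller side contains
both. -/
theorem exists_partner (hw : IsCompatibleSplitWeight w) {A : Finset ι} (hA : 1 < A.card)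
    (hA' : 0 < w A) {i : ι} (hi : i ∈ A) : ∃ j ∈ A, i ≠ j ∧
      ∀ B, 0 < w B → i ∈ B → j ∈ B → ∀ k, k ∉ A → k ∉ B → A ⊆ B := by
  obtain ⟨C, hC, hmax⟩ := Finset.exists_max_image
    (Finset.univ.filter fun C => 0 < w C ∧ i ∈ C ∧ C ⊂ A) Finset.card
    ⟨{i}, by
      simp only [Finset.mem_filter, Finset.mem_univ, hw.singleton_pos, Finset.mem_singleton,
        true_and]
      exact Finset.ssubset_iff_subset_ne.2 ⟨by simpa using hi, by rintro rfl; simp at hA⟩⟩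
  simp only [Finset.mem_filter, Finset.mem_univ, true_and, and_imp] at hC hmax
  obtain ⟨hC, hiC, hCA⟩ := hC
  obtain ⟨j, hjA, hjC⟩ := Finset.exists_of_ssubset hCA
  refine ⟨j, hjA, ne_of_mem_of_not_mem hiC hjC, fun B hB hiB hjB k hkA hkB => ?_⟩
  rcases hw.subset_or_subset hA' hB hi hiB hkA hkB with h | h
  · exact h
  by_contra hAB
  rcases hw.subset_or_subset hC hB hiC hiB (fun h => hkA (hCA.1 h)) hkB with h' | h'
  · have := Finset.eq_of_subset_of_card_le h' (hmax B hB hiB ⟨h, hAB⟩)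
    exact hjC (this ▸ hjB)
  · exact hjC (h' hjB)

theorem eq_of_one_lt_card (hw : IsCompatibleSplitWeight w)
    (hw' : IsCompatibleSplitWeight w') {m : ℕ} (hm : 3 ≤ m) (hn : 2 * m - 1 ≤ Fintype.card ι)
    (hD : ∀ I : Finset ι, I.card = m → splitDiversity w I = splitDiversity w' I)
    {A : Finset ι} (h1 : 1 < A.card) (h2 : 1 < Aᶜ.card) : w A = w' A := by
  have hpos : ∀ B, 0 < w B ↔ 0 < w' B := fun B =>
    ⟨hw.pos_of_splitDiversity_eq hw' hm hn hD,
      hw'.pos_of_splitDiversity_eq hw hm hn fun I hI => (hD I hI).symm⟩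
  have hzero : ∀ B, ¬ 0 < w B → w B = 0 ∧ w' B = 0 := fun B hB =>
    ⟨le_antisymm (not_lt.1 hB) (hw.nonneg B),
      le_antisymm (not_lt.1 (mt (hpos B).2 hB)) (hw'.nonneg B)⟩
  by_cases hA : 0 < w A
  swap
  · rw [(hzero A hA).1, (hzero A hA).2]
  obtain ⟨i, hi⟩ : A.Nonempty := Finset.card_pos.1 (by omega)
  obtain ⟨k, hk⟩ : Aᶜ.Nonempty := Finset.card_pos.1 (by omega)
  obtain ⟨j, hj, hij, hAj⟩ := hw.exists_partner h1 hA hi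
  obtain ⟨l, hl, hkl, hAl⟩ := hw.exists_partner h2 (by rwa [hw.compl]) hk
  rw [Finset.mem_compl] at hk hl
  have huniq : ∀ B, 0 < w B → i ∈ B → j ∈ B → k ∉ B → l ∉ B → B = A := by
    intro B hB hiB hjB hkB hlB
    refine Finset.Subset.antisymm ?_ (hAj B hB hiB hjB k hk hkB)
    exact Finset.compl_subset_compl.1 (hAl Bᶜ (by rwa [hw.compl]) (by simpa) (by simpa) i
      (by simpa) (by simpa))
  obtain ⟨R, hRc, hRA, hiR, hjR, hkR, hlR⟩ := exists_card_subset_side hm hn A hi hj hk hl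
  have hR : R.Nonempty := Finset.card_pos.1 (by omega)
  have hsum := sum_quartetCoeff_eq hm hD hij hkl (ne_of_mem_of_not_mem hi hk)
    (ne_of_mem_of_not_mem hj hl) hRc hiR hjR hkR hlR
  have hcoeff : ∀ B, 0 < w B → B ≠ A → B ≠ Aᶜ → quartetCoeff R i j k l B = 0 := by
    intro B hB hBA hBA'
    refine ((hw.quartetCoeff_nonneg hR ⟨A, hA, hi, hj, hk, hl⟩ hB).eq_or_lt).elim Eq.symm
      fun h => ?_
    obtain ⟨C, hC, hCw, hiC, hjC, hkC, hlC⟩ := hw.hasQuartet_of_quartetCoeff_pos hR hB h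
    have := huniq C hCw hiC hjC hkC hlC
    rcases hC with rfl | rfl
    · exact (hBA this).elim
    · exact (hBA' (by rw [← this, compl_compl])).elim
  have hc1 := quartetCoeff_eq_one hR hi hj hk hl hRA
  have hne : A ≠ Aᶜ := fun h => by
    rw [h] at hi
    exact Finset.mem_compl.1 hi (h ▸ hi)
  have hc2 : 0 ≤ quartetCoeff R i j k l Aᶜ :=
    hw.quartetCoeff_nonneg hR ⟨A, hA, hi, hj, hk, hl⟩ (by rwa [hw.compl])
  rw [← sub_eq_zero, ← Finset.sum_sub_distrib, ← Finset.sum_subset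
    (Finset.subset_univ {A, Aᶜ}), Finset.sum_pair hne, hc1, hw.compl, hw'.compl] at hsum
  · have : (w A - w' A) * (1 + quartetCoeff R i j k l Aᶜ) = 0 := by linear_combination hsum
    rcases mul_eq_zero.1 this with h | h <;> linarith
  · intro B _ hB
    simp only [Finset.mem_insert, Finset.mem_singleton, not_or] at hB
    by_cases hwB : 0 < w B
    · simp [hcoeff B hwB hB.1 hB.2]
    · simp [hzero B hwB]

/-- A compatible split weight is determined by the diversities of the sets of size `m`. -/
theorem eq_of_splitDiversity_eq (hw : IsCompatibleSplitWeight w)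
    (hw' : IsCompatibleSplitWeight w') {m : ℕ} (hm : 3 ≤ m) (hn : 2 * m - 1 ≤ Fintype.card ι)
    (hD : ∀ I : Finset ι, I.card = m → splitDiversity w I = splitDiversity w' I) : w = w' := by
  set δ : ι → ℝ := fun i => w {i} - w' {i} with hδ
  have hsum : ∀ I : Finset ι, I.card = m → ∑ i ∈ I, δ i = 0 := by
    intro I hI
    have hcut : ∀ i, cutIndicator I {i} = if i ∈ I then 1 else 0 := by
      intro i
      have : ¬ I ⊆ {i} := fun h => by
        have := Finset.card_le_card h
        simp at this
        omega
      simp [cutIndicator, this]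
    have hcut' : ∀ A, cutIndicator I Aᶜ = cutIndicator I A := by
      intro A
      have h1 : I ⊆ Aᶜ ↔ Disjoint I A := by
        rw [Finset.subset_compl_iff_disjoint_right]
      have h2 : Disjoint I Aᶜ ↔ I ⊆ A := by
        rw [← Finset.subset_compl_iff_disjoint_right, compl_compl]
      simp [cutIndicator, h1, h2, or_comm]
    have h := hD I hI
    set T : Finset (Finset ι) := Finset.univ.map ⟨fun i => {i}, Finset.singleton_injective⟩
    set T' : Finset (Finset ι) := Finset.univ.map ⟨fun i => {i}ᶜ,
      compl_injective.comp Finset.singleton_injective⟩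
    have hdisj : Disjoint T T' := by
      rw [Finset.disjoint_left]
      intro A hA hA'
      simp only [T, T', Finset.mem_map, Finset.mem_univ, true_and, Function.Embedding.coeFn_mk]
        at hA hA'
      obtain ⟨a, rfl⟩ := hA
      obtain ⟨b, hb⟩ := hA'
      have := congrArg Finset.card hb
      simp [Finset.card_compl] at this
      omega
    unfold splitDiversity at h
    rw [← sub_eq_zero, ← Finset.sum_sub_distrib, ← Finset.sum_subset
      (Finset.subset_univ (T ∪ T')), Finset.sum_union hdisj] at h
    · simp only [T, T', Finset.sum_map, Function.Embedding.coeFn_mk, hw.compl, hw'.compl, hcut',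
        hcut, mul_ite, mul_one, mul_zero, ← sub_mul] at h
      simp only [Finset.sum_sub_distrib, Finset.sum_ite_mem, Finset.univ_inter] at h
      simp only [hδ, Finset.sum_sub_distrib]
      linarith
    · intro A _ hA
      simp only [T, T', Finset.mem_union, Finset.mem_map, Finset.mem_univ, true_and,
        Function.Embedding.coeFn_mk, not_or, not_exists] at hA
      have : w A = w' A := by
        by_cases hA' : 0 < w A
        · rcases hw.one_lt_card_or hA' with ⟨h1, h2⟩ | ⟨i, hi | hi⟩
          · exact hw.eq_of_one_lt_card hw' hm hn hD h1 h2
          · exact (hA.1 i hi.symm).elim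
          · exact (hA.2 i hi.symm).elim
        · have h' : ¬ 0 < w' A := fun h' => hA' (hw'.pos_of_splitDiversity_eq hw hm hn
            (fun I hI => (hD I hI).symm) h')
          linarith [hw.nonneg A, hw'.nonneg A]
      rw [this, sub_self]
  have hconst : ∀ i j, δ i = δ j := by
    intro i j
    by_cases hij : i = j
    · rw [hij]
    obtain ⟨R, hR, hRc⟩ := Finset.exists_subset_card_eq (s := (Finset.univ.erase i).erase j)
      (n := m - 1) (by
        have := Finset.pred_card_le_card_erase (s := (Finset.univ : Finset ι)) (a := i)
        have := Finset.pred_card_le_card_erase (s := (Finset.univ : Finset ι).erase i) (a := j)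
        have : (Finset.univ : Finset ι).card = Fintype.card ι := rfl
        omega)
    have hiR : i ∉ R := fun h => by simpa using hR h
    have hjR : j ∉ R := fun h => by simpa using hR h
    have h1 := hsum (insert i R) (by rw [Finset.card_insert_of_notMem hiR]; omega)
    have h2 := hsum (insert j R) (by rw [Finset.card_insert_of_notMem hjR]; omega)
    rw [Finset.sum_insert hiR] at h1
    rw [Finset.sum_insert hjR] at h2
    linarith
  have hδ0 : ∀ i, w {i} = w' {i} := by
    intro i
    obtain ⟨I, -, hI⟩ := Finset.exists_subset_card_eq (s := (Finset.univ : Finset ι))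
      (n := m) (by
        have : (Finset.univ : Finset ι).card = Fintype.card ι := rfl
        omega)
    have h := hsum I hI
    rw [Finset.sum_congr rfl fun j _ => hconst j i, Finset.sum_const, hI, nsmul_eq_mul,
      mul_eq_zero] at h
    rcases h with h | h
    · norm_cast at h
      omega
    · exact sub_eq_zero.1 h
  funext A
  by_cases hA : 0 < w A
  · rcases hw.one_lt_card_or hA with ⟨h1, h2⟩ | ⟨i, rfl | rfl⟩
    · exact hw.eq_of_one_lt_card hw' hm hn hD h1 h2
    · exact hδ0 i
    · rw [hw.compl, hw'.compl, hδ0]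
  · have h' : ¬ 0 < w' A := fun h' => hA (hw'.pos_of_splitDiversity_eq hw hm hn
      (fun I hI => (hD I hI).symm) h')
    linarith [hw.nonneg A, hw'.nonneg A]

end IsCompatibleSplitWeight

end SplitWeights

namespace SimpleGraph

variable {V : Type*} {G : SimpleGraph V}

/-- The vertices `x` and `y` are connected by a walk avoiding `e`. -/
def SameSide (G : SimpleGraph V) (e : Sym2 V) (x y : V) : Prop :=
  ∃ p : G.Walk x y, e ∉ p.edges

namespace SameSide

theorem refl (e : Sym2 V) (x : V) : G.SameSide e x x := ⟨.nil, by simp⟩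

theorem symm {e : Sym2 V} {x y : V} (h : G.SameSide e x y) : G.SameSide e y x := by
  obtain ⟨p, hp⟩ := h
  exact ⟨p.reverse, by simpa using hp⟩

theorem trans {e : Sym2 V} {x y z : V} (h : G.SameSide e x y) (h' : G.SameSide e y z) :
    G.SameSide e x z := by
  obtain ⟨p, hp⟩ := h
  obtain ⟨q, hq⟩ := h'
  exact ⟨p.append q, by simp [Walk.edges_append, hp, hq]⟩

theorem of_adj {e : Sym2 V} {x y : V} (h : G.Adj x y) (he : s(x, y) ≠ e) : G.SameSide e x y :=
  ⟨h.toWalk, by simpa using he.symm⟩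

/-- A walk avoiding `f` either avoids `e` as well, or contains the ends of `e`. -/
theorem of_sameSide {e f : Sym2 V} {x y : V} (h : G.SameSide f x y) :
    G.SameSide e x y ∨ ∀ c ∈ e, G.SameSide f x c := by
  classical
  obtain ⟨p, hp⟩ := h
  by_cases he : e ∈ p.edges
  · refine Or.inr fun c hc => ?_
    have hcp : c ∈ p.support := p.mem_support_of_mem_edges he hc
    exact ⟨p.takeUntil c hcp, fun h => hp (p.edges_takeUntil_subset_edges hcp h)⟩
  · exact Or.inl ⟨p, he⟩

end SameSide

theorem Connected.sameSide_or (hG : G.Connected) (a b x : V) :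
    G.SameSide s(a, b) x a ∨ G.SameSide s(a, b) x b := by
  obtain ⟨p⟩ := hG.preconnected x a
  induction p with
  | nil => exact Or.inl (.refl _ _)
  | @cons x y c h p ih =>
    by_cases he : s(x, y) = s(c, b)
    · rcases Sym2.eq_iff.1 he with ⟨rfl, -⟩ | ⟨rfl, -⟩
      · exact Or.inl (.refl _ _)
      · exact Or.inr (.refl _ _)
    · exact ih.imp (SameSide.of_adj h he).trans (SameSide.of_adj h he).trans

theorem IsAcyclic.not_sameSide (hG : G.IsAcyclic) {a b : V} (h : G.Adj a b) :
    ¬ G.SameSide s(a, b) a b := by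
  rintro ⟨p, hp⟩
  exact hp (isBridge_iff_forall_walk_mem_edges.1 (isAcyclic_iff_forall_adj_isBridge.1 hG h) p)

theorem IsAcyclic.mem_edges_iff (hG : G.IsAcyclic) {x y : V} {p : G.Walk x y} (hp : p.IsPath)
    {e : Sym2 V} : e ∈ p.edges ↔ ¬ G.SameSide e x y := by
  classical
  refine ⟨fun he ⟨q, hq⟩ => hq ?_, fun h => by_contra fun he => h ⟨p, he⟩⟩
  have := congrArg Subtype.val ((hG.subsingleton_path x y).elim ⟨p, hp⟩ q.toPath)
  exact q.edges_toPath_subset_edges (by rwa [← this])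

theorem IsTree.exists_adj_not_sameSide (hG : G.IsTree) {x y : V} (hxy : x ≠ y) :
    ∃ z, G.Adj x z ∧ ¬ G.SameSide s(x, z) y x := by
  obtain ⟨p, hp, -⟩ := hG.existsUnique_path x y
  cases p with
  | nil => exact (hxy rfl).elim
  | @cons _ z _ h p =>
    exact ⟨z, h, fun hs => (hG.isAcyclic.mem_edges_iff hp).1 (by simp) hs.symm⟩

/-- Beyond an edge `s(x, y)`, the branch at another neighbour `z` of `y` lies on the side
of `y`. -/
theorem IsAcyclic.sameSide_of_branch (hG : G.IsAcyclic) {x y z u : V}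
    (hyz : G.Adj y z) (hxz : x ≠ z) (h : G.SameSide s(y, z) u z) : G.SameSide s(x, y) u y := by
  rcases h.of_sameSide (e := s(x, y)) with h' | h'
  · refine h'.trans (.of_adj hyz.symm fun h => ?_)
    rcases Sym2.eq_iff.1 h with ⟨h1, h2⟩ | ⟨h1, -⟩
    · exact hxz h1.symm
    · exact hyz.ne h1.symm
  · exact (hG.not_sameSide hyz ((h' y (by simp)).symm.trans h)).elim

/-- The vertex `m` lies on the same side as at least two of `x, y, z`, for every edge. -/
def IsMedian (G : SimpleGraph V) (m x y z : V) : Prop :=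
  ∀ e, (G.SameSide e m x ∧ G.SameSide e m y) ∨ (G.SameSide e m x ∧ G.SameSide e m z) ∨
    (G.SameSide e m y ∧ G.SameSide e m z)

theorem IsMedian.sameSide_iff {m x y z : V} (h : G.IsMedian m x y z) (e : Sym2 V) (a : V) :
    G.SameSide e m a ↔ (G.SameSide e x a ∧ G.SameSide e y a) ∨
      (G.SameSide e x a ∧ G.SameSide e z a) ∨ (G.SameSide e y a ∧ G.SameSide e z a) := by
  constructor
  · intro hma
    have key : ∀ {u}, G.SameSide e m u → G.SameSide e u a := fun hu => hu.symm.trans hma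
    exact (h e).imp (.imp key key) (.imp (.imp key key) (.imp key key))
  · intro ha
    rcases h e with ⟨h1, h2⟩ | ⟨h1, h2⟩ | ⟨h1, h2⟩ <;>
      rcases ha with ⟨h3, h4⟩ | ⟨h3, h4⟩ | ⟨h3, h4⟩ <;>
      first
      | exact h1.trans h3
      | exact h1.trans h4
      | exact h2.trans h3
      | exact h2.trans h4

theorem IsTree.exists_isMedian (hG : G.IsTree) (x y z : V) : ∃ m, G.IsMedian m x y z := by
  obtain ⟨p⟩ := hG.connected.preconnected x y
  induction p with
  | @nil x => exact ⟨x, fun e => Or.inl ⟨.refl _ _, .refl _ _⟩⟩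
  | @cons x x' y h p ih =>
    obtain ⟨m, hm⟩ := ih
    set g := s(x, x') with hg
    have hx : ∀ {e}, e ≠ g → G.SameSide e x' x := fun he => (SameSide.of_adj h he.symm).symm
    by_cases hgm : G.SameSide g m y ∧ G.SameSide g m z
    · refine ⟨m, fun e => ?_⟩
      by_cases he : e = g
      · exact Or.inr (Or.inr (he ▸ hgm))
      · exact (hm e).imp (.imp_left fun h => h.trans (hx he))
          (.imp_left (.imp_left fun h => h.trans (hx he)))
    · refine ⟨x, ?_⟩
      have hcross : ∀ {u v e}, G.SameSide g u x' → G.SameSide g v x → e ≠ g →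
          G.SameSide e u v → G.SameSide e x u := by
        intro u v e hu hv he huv
        rcases hu.of_sameSide (e := e) with h1 | h1
        · exact (h1.trans (hx he)).symm
        rcases hv.of_sameSide (e := e) with h2 | h2
        · exact (huv.trans h2).symm
        exfalso
        induction e with
        | h c d =>
          have h3 := (h1 c (by simp)).symm.trans hu
          have h4 := (h2 c (by simp)).symm.trans hv
          exact hG.isAcyclic.not_sameSide h (h4.symm.trans h3)
      have hside : (G.SameSide g y x' ∧ G.SameSide g z x) ∨
          (G.SameSide g z x' ∧ G.SameSide g y x) := by
        have hor := hG.connected.sameSide_or x x'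
        rcases hm g with ⟨h1, h2⟩ | ⟨h1, h2⟩ | h1
        · refine Or.inl ⟨h2.symm.trans h1, (hor z).resolve_right fun h3 => ?_⟩
          exact hgm ⟨h2, h1.trans h3.symm⟩
        · refine Or.inr ⟨h2.symm.trans h1, (hor y).resolve_right fun h3 => ?_⟩
          exact hgm ⟨h1.trans h3.symm, h2⟩
        · exact (hgm h1).elim
      intro e
      by_cases he : e = g
      · subst he
        exact hside.symm.imp (fun h => ⟨.refl _ _, h.2.symm⟩)
          fun h => Or.inl ⟨.refl _ _, h.2.symm⟩
      rcases hm e with ⟨h1, h2⟩ | ⟨h1, h2⟩ | ⟨h1, h2⟩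
      · exact Or.inl ⟨.refl _ _, (hx he).symm.trans (h1.symm.trans h2)⟩
      · exact Or.inr (Or.inl ⟨.refl _ _, (hx he).symm.trans (h1.symm.trans h2)⟩)
      · rcases hside with h3 | h3
        · exact Or.inl ⟨.refl _ _, hcross h3.1 h3.2 he (h1.symm.trans h2)⟩
        · exact Or.inr (Or.inl ⟨.refl _ _, hcross h3.1 h3.2 he (h2.symm.trans h1)⟩)

/-- Vertices in two different branches at `v` are not both separated from `v` by an edge. -/
theorem IsAcyclic.sameSide_or_of_branches (hG : G.IsAcyclic) {v z₁ z₂ l₁ l₂ : V}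
    (h₁ : G.Adj v z₁) (h₂ : G.Adj v z₂) (hz : z₁ ≠ z₂) (hl₁ : G.SameSide s(v, z₁) l₁ z₁)
    (hl₂ : G.SameSide s(v, z₂) l₂ z₂) (e : Sym2 V) :
    G.SameSide e v l₁ ∨ G.SameSide e v l₂ := by
  by_contra! hcon
  have key : ∀ {z l}, G.Adj v z → G.SameSide s(v, z) l z → ¬ G.SameSide e v l →
      e = s(v, z) ∨ ∀ c ∈ e, G.SameSide s(v, z) c z := by
    intro z l h hl he
    rcases eq_or_ne e s(v, z) with h' | h'
    · exact Or.inl h'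
    refine Or.inr fun c hc => ?_
    rcases hl.of_sameSide (e := e) with h1 | h1
    · exact (he (h1.trans (SameSide.of_adj h h'.symm).symm).symm).elim
    · exact (h1 c hc).symm.trans hl
  rcases key h₁ hl₁ hcon.1 with h3 | h3 <;> rcases key h₂ hl₂ hcon.2 with h4 | h4
  · exact hz (Sym2.congr_right.1 (h3.symm.trans h4))
  · exact hG.not_sameSide h₂ (h4 v (by simp [h3]))
  · exact hG.not_sameSide h₁ (h3 v (by simp [h4]))
  · induction e with
    | h c d =>
      have h5 := h3 c (by simp)
      have h6 := hG.sameSide_of_branch h₂ hz (h4 c (by simp))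
      rw [Sym2.eq_swap] at h6
      exact hG.not_sameSide h₁ (h6.symm.trans h5)

/-- If a unique dart separates `p` from `q`, then it goes from `p` to `q`. -/
theorem IsTree.eq_fst_and_eq_snd (hG : G.IsTree) {p q : V} (hpq : p ≠ q) {d : G.Dart}
    (hd : ∀ d' : G.Dart, G.SameSide d'.edge p d'.fst → ¬ G.SameSide d'.edge q d'.fst → d' = d) :
    p = d.fst ∧ q = d.snd := by
  obtain ⟨r, hpr, hr⟩ := hG.exists_adj_not_sameSide hpq
  obtain ⟨t, hqt, ht⟩ := hG.exists_adj_not_sameSide hpq.symm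
  have h1 := hd ⟨(p, r), hpr⟩ (.refl _ _) hr
  have h2 := hd ⟨(t, q), hqt.symm⟩
    (by simpa [Sym2.eq_swap] using (hG.connected.sameSide_or q t p).resolve_left ht)
    (by simpa [Sym2.eq_swap] using hG.isAcyclic.not_sameSide hqt)
  exact ⟨by rw [← h1], by rw [← h2]⟩

theorem sum_dart_edge [Fintype V] [DecidableEq V] [DecidableRel G.Adj] (g : Sym2 V → ℝ) :
    ∑ d : G.Dart, g d.edge = 2 * ∑ e ∈ G.edgeFinset, g e := by
  rw [← Finset.sum_fiberwise_of_maps_to (s := Finset.univ) (t := G.edgeFinset)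
    (g := Dart.edge) (fun d _ => by simp), Finset.mul_sum]
  refine Finset.sum_congr rfl fun e he => ?_
  rw [Finset.sum_congr rfl fun d hd => by rw [(Finset.mem_filter.1 hd).2], Finset.sum_const,
    G.dart_edge_fiber_card e (by simpa using he)]
  simp

end SimpleGraph

namespace WeightedTree

variable {n : ℕ} (T : WeightedTree n)

theorem mem_edges_treePath {u v : T.V} {e : Sym2 T.V} :
    e ∈ (T.treePath u v).edges ↔ ¬ T.G.SameSide e u v :=
  T.isTree.isAcyclic.mem_edges_iff (T.isTree.existsUnique_path u v).choose_spec.1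

theorem exists_leaf_sameSide {x y : T.V} (h : T.G.Adj x y) :
    ∃ i, T.G.SameSide s(x, y) (T.leaf i) y := by
  classical
  induction hN : (Finset.univ.filter fun u => T.G.SameSide s(x, y) u y).card using
    Nat.strong_induction_on generalizing x y with
  | _ N ih =>
    subst hN
    by_cases hy : T.G.degree y ≤ 1
    · obtain ⟨i, hi⟩ := (T.leaf_iff y).2 hy
      exact ⟨i, hi ▸ .refl _ _⟩
    · obtain ⟨z, hz, hzx⟩ := Finset.exists_mem_ne
        (by simpa [SimpleGraph.card_neighborFinset_eq_degree] using hy :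
          1 < (T.G.neighborFinset y).card) x
      rw [SimpleGraph.mem_neighborFinset] at hz
      have hsub : ∀ u, T.G.SameSide s(y, z) u z → T.G.SameSide s(x, y) u y :=
        fun u => T.isTree.isAcyclic.sameSide_of_branch hz hzx.symm
      obtain ⟨i, hi⟩ := ih _ (Finset.card_lt_card (Finset.ssubset_iff_of_subset
        (fun u hu => by simpa using hsub u (by simpa using hu)) |>.2
          ⟨y, by simpa using .refl _ _, by simpa using T.isTree.isAcyclic.not_sameSide hz⟩)) hz rfl
      exact ⟨i, hsub _ hi⟩

theorem exists_isMedian_leaf (hdeg : ∀ v : T.V, T.G.degree v ≠ 2) (v : T.V) :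
    ∃ i j k, T.G.IsMedian v (T.leaf i) (T.leaf j) (T.leaf k) := by
  by_cases hv : T.G.degree v ≤ 1
  · obtain ⟨i, rfl⟩ := (T.leaf_iff v).2 hv
    exact ⟨i, i, i, fun e => Or.inl ⟨.refl _ _, .refl _ _⟩⟩
  · have h3 : 2 < (T.G.neighborFinset v).card := by
      have := hdeg v
      rw [SimpleGraph.card_neighborFinset_eq_degree]
      omega
    obtain ⟨a, ha, b, hb, c, hc, hab, hac, hbc⟩ := Finset.two_lt_card.1 h3
    rw [SimpleGraph.mem_neighborFinset] at ha hb hc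
    obtain ⟨i, hi⟩ := T.exists_leaf_sameSide ha
    obtain ⟨j, hj⟩ := T.exists_leaf_sameSide hb
    obtain ⟨k, hk⟩ := T.exists_leaf_sameSide hc
    refine ⟨i, j, k, fun e => ?_⟩
    have h1 := T.isTree.isAcyclic.sameSide_or_of_branches ha hb hab hi hj e
    have h2 := T.isTree.isAcyclic.sameSide_or_of_branches ha hc hac hi hk e
    have h3 := T.isTree.isAcyclic.sameSide_or_of_branches hb hc hbc hj hk e
    tauto

open Classical in
/-- The leaves on the side of the first vertex of a dart. -/
noncomputable def cluster (d : T.G.Dart) : Finset (Fin n) :=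
  Finset.univ.filter fun i => T.G.SameSide d.edge (T.leaf i) d.fst

/-- The weight function on splits of the leaf set induced by the edge weights. -/
noncomputable def splitWeight (A : Finset (Fin n)) : ℝ :=
  ∑ d : T.G.Dart, if T.cluster d = A then T.w d.edge else 0

variable {T}

theorem mem_cluster {d : T.G.Dart} {i : Fin n} :
    i ∈ T.cluster d ↔ T.G.SameSide d.edge (T.leaf i) d.fst := by
  simp [cluster]

theorem sameSide_fst_or_snd (d : T.G.Dart) (x : T.V) :
    T.G.SameSide d.edge x d.fst ∨ T.G.SameSide d.edge x d.snd :=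
  T.isTree.connected.sameSide_or d.fst d.snd x

theorem not_sameSide_fst_snd (d : T.G.Dart) : ¬ T.G.SameSide d.edge d.fst d.snd :=
  T.isTree.isAcyclic.not_sameSide d.adj

theorem sameSide_snd_iff (d : T.G.Dart) (x : T.V) :
    T.G.SameSide d.edge x d.snd ↔ ¬ T.G.SameSide d.edge x d.fst :=
  ⟨fun h h' => not_sameSide_fst_snd d (h'.symm.trans h),
    fun h => (sameSide_fst_or_snd d x).resolve_left h⟩

theorem cluster_symm (d : T.G.Dart) : T.cluster d.symm = (T.cluster d)ᶜ := by
  ext i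
  rw [Finset.mem_compl, mem_cluster, mem_cluster, SimpleGraph.Dart.edge_symm]
  exact sameSide_snd_iff d _

theorem cluster_nonempty (d : T.G.Dart) : (T.cluster d).Nonempty := by
  obtain ⟨i, hi⟩ := T.exists_leaf_sameSide d.adj.symm
  rw [Sym2.eq_swap] at hi
  exact ⟨i, mem_cluster.2 hi⟩

theorem sameSide_iff_of_cluster_eq {T' : WeightedTree n} {d : T.G.Dart} {d' : T'.G.Dart}
    (h : T.cluster d = T'.cluster d') {v : T.V} {v' : T'.V} {i j k : Fin n}
    (hv : T.G.IsMedian v (T.leaf i) (T.leaf j) (T.leaf k))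
    (hv' : T'.G.IsMedian v' (T'.leaf i) (T'.leaf j) (T'.leaf k)) :
    T.G.SameSide d.edge v d.fst ↔ T'.G.SameSide d'.edge v' d'.fst := by
  rw [hv.sameSide_iff, hv'.sameSide_iff]
  simp only [← mem_cluster, h]

theorem cluster_injective (hdeg : ∀ v : T.V, T.G.degree v ≠ 2) :
    Function.Injective T.cluster := by
  intro d d' h
  have key : ∀ v, T.G.SameSide d.edge v d.fst ↔ T.G.SameSide d'.edge v d'.fst := by
    intro v
    obtain ⟨i, j, k, hv⟩ := T.exists_isMedian_leaf hdeg v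
    exact sameSide_iff_of_cluster_eq h hv hv
  by_cases he : d.edge = d'.edge
  · refine ((SimpleGraph.dart_edge_eq_iff d d').1 he).resolve_right fun hs => ?_
    subst hs
    have h1 := (key d'.snd).1 (.refl _ _)
    exact not_sameSide_fst_snd d' h1.symm
  · have h1 := (key d.fst).1 (.refl _ _)
    have h2 := (SimpleGraph.SameSide.of_adj d.adj he).symm.trans h1
    exact (not_sameSide_fst_snd d ((key d.snd).2 h2).symm).elim

theorem splitWeight_cluster (hdeg : ∀ v : T.V, T.G.degree v ≠ 2) (d : T.G.Dart) :
    T.splitWeight (T.cluster d) = T.w d.edge := by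
  simp [splitWeight, (cluster_injective hdeg).eq_iff]

theorem exists_cluster_eq_of_splitWeight_pos {A : Finset (Fin n)} (h : 0 < T.splitWeight A) :
    ∃ d, T.cluster d = A := by
  by_contra! hA
  simp [splitWeight, hA] at h

theorem singleton_mem_range_cluster (hn : 2 ≤ n) (i : Fin n) : ∃ d, T.cluster d = {i} := by
  obtain ⟨j, hj⟩ : ∃ j, j ≠ i := by
    have : Nontrivial (Fin n) := Fin.nontrivial_iff_two_le.2 hn
    exact exists_ne i
  have hunique : ∀ j, j ≠ i → ∃ z, T.G.Adj (T.leaf i) z ∧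
      ¬ T.G.SameSide s(T.leaf i, z) (T.leaf j) (T.leaf i) := fun j hj =>
    T.isTree.exists_adj_not_sameSide (T.leaf_inj.ne hj.symm)
  obtain ⟨z, hz, -⟩ := hunique j hj
  refine ⟨⟨(T.leaf i, z), hz⟩, ?_⟩
  ext k
  rw [mem_cluster, Finset.mem_singleton]
  refine ⟨fun hk => by_contra fun hki => ?_, by rintro rfl; exact .refl _ _⟩
  obtain ⟨y, hy, hky⟩ := hunique k hki
  have hdeg := (T.leaf_iff (T.leaf i)).1 ⟨i, rfl⟩
  rw [← SimpleGraph.card_neighborFinset_eq_degree, Finset.card_le_one] at hdeg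
  have := hdeg y (by simpa using hy) z (by simpa using hz)
  exact hky (this ▸ hk)

theorem splitWeight_compat {A B : Finset (Fin n)} (hA : 0 < T.splitWeight A)
    (hB : 0 < T.splitWeight B) {i j k l : Fin n} (hiA : i ∈ A) (hiB : i ∈ B) (hjA : j ∈ A)
    (hjB : j ∉ B) (hkA : k ∉ A) (hkB : k ∈ B) (hlA : l ∉ A) (hlB : l ∉ B) : False := by
  obtain ⟨d, rfl⟩ := exists_cluster_eq_of_splitWeight_pos hA
  obtain ⟨d', rfl⟩ := exists_cluster_eq_of_splitWeight_pos hB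
  rw [mem_cluster] at hiA hiB hjA hkB
  rw [mem_cluster, ← sameSide_snd_iff] at hjB hkA hlA hlB
  have hij := hiA.trans hjA.symm
  have hkl := hkA.trans hlA.symm
  have key : ∀ {x y}, T.G.SameSide d'.edge x d'.fst → T.G.SameSide d'.edge y d'.snd →
      ¬ T.G.SameSide d'.edge x y := fun hx hy hxy =>
    not_sameSide_fst_snd d' (hx.symm.trans (hxy.trans hy))
  have h1 := hij.of_sameSide (e := d'.edge) |>.resolve_left (key hiB hjB) d'.fst
    (Sym2.mem_mk_left _ _)
  have h2 := hkl.of_sameSide (e := d'.edge) |>.resolve_left (key hkB hlB) d'.fst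
    (Sym2.mem_mk_left _ _)
  exact not_sameSide_fst_snd d (hiA.symm.trans (h1.trans (h2.symm.trans hkA)))

theorem isCompatibleSplitWeight (hn : 2 ≤ n) (hpos : T.PosWeights)
    (hdeg : ∀ v : T.V, T.G.degree v ≠ 2) : IsCompatibleSplitWeight T.splitWeight where
  nonneg A := Finset.sum_nonneg fun d _ => by
    split_ifs
    exacts [(hpos _ d.edge_mem).le, le_rfl]
  compl A := by
    unfold splitWeight
    rw [← Equiv.sum_comp SimpleGraph.Dart.symm_involutive.toPerm]
    simp [cluster_symm]
  empty := by
    simp [splitWeight, (cluster_nonempty _).ne_empty]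
  singleton_pos i := by
    obtain ⟨d, hd⟩ := singleton_mem_range_cluster hn i
    rw [← hd, splitWeight_cluster hdeg]
    exact hpos _ d.edge_mem
  compat _ _ hA hB _ _ _ _ := splitWeight_compat hA hB

open Classical in
theorem cutIndicator_cluster (I : Finset (Fin n)) (d : T.G.Dart) :
    cutIndicator I (T.cluster d) =
      if ∃ i ∈ I, ∃ j ∈ I, d.edge ∈ (T.treePath (T.leaf i) (T.leaf j)).edges then 1 else 0 := by
  have : (I ⊆ T.cluster d ∨ Disjoint I (T.cluster d)) ↔
      ¬ ∃ i ∈ I, ∃ j ∈ I, d.edge ∈ (T.treePath (T.leaf i) (T.leaf j)).edges := by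
    simp only [mem_edges_treePath]
    push Not
    constructor
    · rintro (h | h) i hi j hj
      · exact (mem_cluster.1 (h hi)).trans (mem_cluster.1 (h hj)).symm
      · have key : ∀ x ∈ I, T.G.SameSide d.edge (T.leaf x) d.snd := fun x hx =>
          (sameSide_snd_iff d _).2 (mt mem_cluster.2 (Finset.disjoint_left.1 h hx))
        exact (key i hi).trans (key j hj).symm
    · intro h
      by_contra! hcon
      obtain ⟨i, hi, hi'⟩ := Finset.not_subset.1 hcon.1
      obtain ⟨j, hj, hj'⟩ := Finset.not_disjoint_iff.1 hcon.2
      exact hi' (mem_cluster.2 ((h i hi j hj).trans (mem_cluster.1 hj')))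
  rw [cutIndicator, if_congr this rfl rfl, ite_not]

theorem splitDiversity_splitWeight (I : Finset (Fin n)) :
    splitDiversity T.splitWeight I = 2 * T.D I := by
  classical
  unfold splitDiversity splitWeight D
  simp_rw [Finset.sum_mul]
  rw [Finset.sum_comm, Finset.sum_filter, ← SimpleGraph.sum_dart_edge]
  refine Finset.sum_congr rfl fun d _ => ?_
  simp [cutIndicator_cluster]

/-- The vertices `v` and `v'` lie on the same side of every common split. -/
def SameSplits (T T' : WeightedTree n) (v : T.V) (v' : T'.V) : Prop :=
  ∀ d d', T.cluster d = T'.cluster d' →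
    (T.G.SameSide d.edge v d.fst ↔ T'.G.SameSide d'.edge v' d'.fst)

variable {T' : WeightedTree n}

theorem SameSplits.symm {v : T.V} {v' : T'.V} (h : SameSplits T T' v v') :
    SameSplits T' T v' v :=
  fun d d' hd => (h d' d hd.symm).symm

theorem sameSplits_leaf (i : Fin n) : SameSplits T T' (T.leaf i) (T'.leaf i) := by
  intro d d' h
  rw [← mem_cluster, ← mem_cluster, h]

theorem exists_sameSplits (hdeg : ∀ v : T.V, T.G.degree v ≠ 2) (v : T.V) :
    ∃ v', SameSplits T T' v v' := by
  obtain ⟨i, j, k, hv⟩ := T.exists_isMedian_leaf hdeg v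
  obtain ⟨v', hv'⟩ := T'.isTree.exists_isMedian (T'.leaf i) (T'.leaf j) (T'.leaf k)
  exact ⟨v', fun d d' h => sameSide_iff_of_cluster_eq h hv hv'⟩

theorem exists_dart_of_splitWeight_eq (hpos : T.PosWeights)
    (hdeg : ∀ v : T.V, T.G.degree v ≠ 2) (hdeg' : ∀ v : T'.V, T'.G.degree v ≠ 2)
    (hw : T.splitWeight = T'.splitWeight) (d : T.G.Dart) :
    ∃ d', T.cluster d = T'.cluster d' ∧ T.w d.edge = T'.w d'.edge := by
  have h := congrFun hw (T.cluster d)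
  rw [splitWeight_cluster hdeg] at h
  obtain ⟨d', hd'⟩ := exists_cluster_eq_of_splitWeight_pos (h ▸ hpos _ d.edge_mem)
  exact ⟨d', hd'.symm, by rw [h, ← hd', splitWeight_cluster hdeg']⟩

theorem SameSplits.unique (hcl : ∀ d', ∃ d, T'.cluster d' = T.cluster d) {v : T.V} {u' v' : T'.V}
    (hu : SameSplits T T' v u') (hv : SameSplits T T' v v') : u' = v' := by
  by_contra hne
  obtain ⟨z, hz, hz'⟩ := T'.isTree.exists_adj_not_sameSide hne
  obtain ⟨d, hd⟩ := hcl ⟨(u', z), hz⟩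
  exact hz' ((hv _ _ hd.symm).1 ((hu _ _ hd.symm).2 (.refl _ _)))

/-- The vertices corresponding to the ends of a dart are the ends of the corresponding dart. -/
theorem SameSplits.fst_and_snd
    (hcl : ∀ d', ∃ d, T'.cluster d' = T.cluster d) {d : T.G.Dart} {d' : T'.G.Dart}
    (hd : T.cluster d = T'.cluster d') {p q : T'.V} (hp : SameSplits T T' d.fst p)
    (hq : SameSplits T T' d.snd q) (hdeg' : ∀ v : T'.V, T'.G.degree v ≠ 2) :
    p = d'.fst ∧ q = d'.snd := by
  refine T'.isTree.eq_fst_and_eq_snd ?_ fun d₁' h1 h2 => ?_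
  · rintro rfl
    exact not_sameSide_fst_snd d
      ((hq d d' hd).2 ((hp d d' hd).1 (.refl _ _))).symm
  · obtain ⟨d₁, hd₁⟩ := hcl d₁'
    have h3 := (hp _ _ hd₁.symm).2 h1
    have h4 := mt (hq _ _ hd₁.symm).1 h2
    have he : d₁.edge = d.edge := by
      by_contra he
      exact h4 ((SimpleGraph.SameSide.of_adj d.adj (Ne.symm he)).symm.trans h3)
    rcases (SimpleGraph.dart_edge_eq_iff _ _).1 he with rfl | rfl
    · exact cluster_injective hdeg' (hd₁.trans hd)
    · exact (h4 (.refl _ _)).elim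

theorem weightedTreeIso_of_splitWeight_eq (hpos : T.PosWeights) (hpos' : T'.PosWeights)
    (hdeg : ∀ v : T.V, T.G.degree v ≠ 2) (hdeg' : ∀ v : T'.V, T'.G.degree v ≠ 2)
    (hw : T.splitWeight = T'.splitWeight) : WeightedTreeIso T T' := by
  have hcl : ∀ d, ∃ d', T.cluster d = T'.cluster d' ∧ T.w d.edge = T'.w d'.edge :=
    exists_dart_of_splitWeight_eq hpos hdeg hdeg' hw
  have hcl' : ∀ d', ∃ d, T'.cluster d' = T.cluster d := fun d' =>
    (exists_dart_of_splitWeight_eq hpos' hdeg' hdeg hw.symm d').imp fun _ h => h.1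
  have hcl₁ : ∀ d, ∃ d', T.cluster d = T'.cluster d' := fun d => (hcl d).imp fun _ h => h.1
  choose f hf using exists_sameSplits (T := T) (T' := T') hdeg
  choose g hg using exists_sameSplits (T := T') (T' := T) hdeg'
  have hgf : ∀ v, g (f v) = v := fun v => (hg (f v)).unique hcl₁ (hf v).symm
  have hfg : ∀ v, f (g v) = v := fun v => (hf (g v)).unique hcl' (hg v).symm
  have hdart : ∀ d : T.G.Dart, ∃ d' : T'.G.Dart, f d.fst = d'.fst ∧ f d.snd = d'.snd ∧
      T.w d.edge = T'.w d'.edge := by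
    intro d
    obtain ⟨d', hd', hwd⟩ := hcl d
    obtain ⟨h1, h2⟩ := SameSplits.fst_and_snd hcl' hd' (hf d.fst) (hf d.snd) hdeg'
    exact ⟨d', h1, h2, hwd⟩
  refine ⟨⟨⟨f, g, hgf, hfg⟩, ?_⟩, ?_, ?_⟩
  · intro u v
    simp only [Equiv.coe_fn_mk]
    constructor
    · intro h
      obtain ⟨d, hd⟩ := hcl' ⟨(f u, f v), h⟩
      obtain ⟨h1, h2⟩ := SameSplits.fst_and_snd hcl₁ hd (hf u).symm (hf v).symm hdeg
      rw [h1, h2]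
      exact d.adj
    · intro h
      obtain ⟨d', h1, h2, -⟩ := hdart ⟨(u, v), h⟩
      rw [h1, h2]
      exact d'.adj
  · intro e he
    induction e with
    | h u v =>
      obtain ⟨d', h1, h2, h3⟩ := hdart ⟨(u, v), he⟩
      change T'.w s(f u, f v) = T.w s(u, v)
      rw [h1, h2]
      exact h3.symm
  · intro i
    exact (hf (T.leaf i)).unique hcl' (sameSplits_leaf i)

end WeightedTree

/-- Pachter–Speyer: for `k ≥ 3` and `n ≥ 2k-1`, two
positive-weighted trees with leaf set `[n]`, no vertices of degree 2 and the
same `k`-weights are isomorphic as weighted trees. -/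
theorem tree_determined_by_k_weights (k n : ℕ) (hk : 3 ≤ k) (hn : 2 * k - 1 ≤ n)
    (T T' : WeightedTree n) (hpos : T.PosWeights) (hpos' : T'.PosWeights)
    (hdeg : ∀ v : T.V, T.G.degree v ≠ 2) (hdeg' : ∀ v : T'.V, T'.G.degree v ≠ 2)
    (hD : ∀ I : Finset (Fin n), I.card = k → T.D I = T'.D I) :
    WeightedTreeIso T T' := by
  refine weightedTreeIso_of_splitWeight_eq hpos hpos' hdeg hdeg' ?_
  refine (isCompatibleSplitWeight (by omega) hpos hdeg).eq_of_splitDiversity_eq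
    (isCompatibleSplitWeight (by omega) hpos' hdeg') hk (by simpa using hn) fun I hI => ?_
  rw [splitDiversity_splitWeight, splitDiversity_splitWeight, hD I hI]
end
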